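/- arXiv:math/0612445 — 2 statements merged into one kernel-verified Lean document; each statement's English description precedes it below -/
import Mathlib

section
/- Let f : ℝ → ℝ be admissible. Let (a_ε), (b_ε) be nets of smooth functions on ℝ, (h_ε) a net of smooth functions on ℝ², let (n_{0ε}), (n_{1ε}) be null nets on ℝ and (n_ε) a null net on ℝ². Suppose (u_ε) and (v_ε) are moderate nets of smooth functions on ℝ² such that for each ε: ∂_t²u_ε − ∂_x²u_ε = f(u_ε) + h_ε with u_ε(·,0) = a_ε, ∂_t u_ε(·,0) = b_ε, and ∂_t²v_ε − ∂_x²v_ε = f(v_ε) + h_ε + n_ε with v_ε(·,0) = a_ε + n_{0ε}, ∂_t v_ε(·,0) = b_ε + n_{1ε}. Then (u_ε − v_ε)_{ε∈(0,1]} is a null net on ℝ². -/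
open Real Set Filter MeasureTheory Topology

noncomputable section

/-- An admissible nonlinearity: smooth, vanishing at 0, globally Lipschitz
(bounded first derivative), and all derivatives of at most polynomial growth. -/
def Admissible (f : ℝ → ℝ) : Prop :=
  ContDiff ℝ (⊤ : ℕ∞) f ∧ f 0 = 0 ∧ (∃ L : ℝ, ∀ y : ℝ, |deriv f y| ≤ L) ∧
  ∀ k : ℕ, ∃ C : ℝ, 0 < C ∧ ∃ N : ℕ, ∀ y : ℝ, |iteratedDeriv k f y| ≤ C * (1 + |y|) ^ N

/-- A moderate net of smooth functions. -/
def ModerateNet {E : Type*} [NormedAddCommGroup E] [NormedSpace ℝ E]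
    (u : ℝ → E → ℝ) : Prop :=
  (∀ ε ∈ Set.Ioc (0:ℝ) 1, ContDiff ℝ (⊤ : ℕ∞) (u ε)) ∧
  ∀ K : Set E, IsCompact K → ∀ k : ℕ, ∃ p : ℝ, 0 ≤ p ∧ ∃ C : ℝ, 0 < C ∧ ∃ ε₀ : ℝ, 0 < ε₀ ∧
    ∀ ε ∈ Set.Ioc (0:ℝ) 1, ε ≤ ε₀ → ∀ x ∈ K,
      ‖iteratedFDeriv ℝ k (u ε) x‖ ≤ C * ε ^ (-p)

/-- A null net of smooth functions: all derivatives tend to zero faster than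
any power of `ε`, locally uniformly. -/
def NullNet {E : Type*} [NormedAddCommGroup E] [NormedSpace ℝ E]
    (u : ℝ → E → ℝ) : Prop :=
  (∀ ε ∈ Set.Ioc (0:ℝ) 1, ContDiff ℝ (⊤ : ℕ∞) (u ε)) ∧
  ∀ K : Set E, IsCompact K → ∀ k : ℕ, ∀ q : ℝ, 0 ≤ q → ∃ C : ℝ, 0 < C ∧ ∃ ε₀ : ℝ, 0 < ε₀ ∧
    ∀ ε ∈ Set.Ioc (0:ℝ) 1, ε ≤ ε₀ → ∀ x ∈ K,
      ‖iteratedFDeriv ℝ k (u ε) x‖ ≤ C * ε ^ q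

/-- The wave operator `∂_t² - ∂_x²` on functions of `(x,t) ∈ ℝ²`. -/
def waveOp (w : ℝ × ℝ → ℝ) (p : ℝ × ℝ) : ℝ :=
  iteratedDeriv 2 (fun s => w (p.1, s)) p.2 - iteratedDeriv 2 (fun y => w (y, p.2)) p.1

lemma second_deriv_line (w : ℝ × ℝ → ℝ) (hw : ContDiff ℝ (⊤ : ℕ∞) w) (p d e : ℝ × ℝ) (s : ℝ) :
    HasDerivAt (fun s : ℝ => fderiv ℝ w (p + s • d) e)
      (fderiv ℝ (fderiv ℝ w) (p + s • d) d e) s := by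
  have h1 : ContDiff ℝ (⊤ : ℕ∞) (fderiv ℝ w) := hw.fderiv_right (by simp)
  have h2 : HasFDerivAt (fderiv ℝ w) (fderiv ℝ (fderiv ℝ w) (p + s • d)) (p + s • d) :=
    (h1.differentiable (by simp) _).hasFDerivAt
  have h3 : HasDerivAt (fun s : ℝ => p + s • d) d s := by
    simpa using ((hasDerivAt_id s).smul_const d).const_add p
  have h4 := h2.comp_hasDerivAt s h3
  have h5 := h4.clm_apply (hasDerivAt_const s e)
  simpa using h5

lemma first_deriv_line (w : ℝ × ℝ → ℝ) (hw : ContDiff ℝ (⊤ : ℕ∞) w) (p d : ℝ × ℝ) (s : ℝ) :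
    HasDerivAt (fun s : ℝ => w (p + s • d)) (fderiv ℝ w (p + s • d) d) s := by
  have h2 : HasFDerivAt w (fderiv ℝ w (p + s • d)) (p + s • d) :=
    (hw.differentiable (by simp) _).hasFDerivAt
  have h3 : HasDerivAt (fun s : ℝ => p + s • d) d s := by
    simpa using ((hasDerivAt_id s).smul_const d).const_add p
  exact h2.comp_hasDerivAt s h3

lemma iter_two_line (w : ℝ × ℝ → ℝ) (hw : ContDiff ℝ (⊤ : ℕ∞) w) (p d : ℝ × ℝ) (s : ℝ) :
    iteratedDeriv 2 (fun s : ℝ => w (p + s • d)) s = fderiv ℝ (fderiv ℝ w) (p + s • d) d d := by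
  rw [iteratedDeriv_succ, iteratedDeriv_one]
  have : deriv (fun s : ℝ => w (p + s • d)) = fun s => fderiv ℝ w (p + s • d) d :=
    funext fun s => (first_deriv_line w hw p d s).deriv
  rw [this]
  exact (second_deriv_line w hw p d d s).deriv

lemma waveOp_eq (w : ℝ × ℝ → ℝ) (hw : ContDiff ℝ (⊤ : ℕ∞) w) (p : ℝ × ℝ) :
    waveOp w p = fderiv ℝ (fderiv ℝ w) p (-1, 1) (1, 1) := by
  have e1 : iteratedDeriv 2 (fun s => w (p.1, s)) p.2 = fderiv ℝ (fderiv ℝ w) p (0, 1) (0, 1) := by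
    have := iter_two_line w hw (p.1, 0) (0, 1) p.2
    simpa using this
  have e2 : iteratedDeriv 2 (fun y => w (y, p.2)) p.1 = fderiv ℝ (fderiv ℝ w) p (1, 0) (1, 0) := by
    have := iter_two_line w hw (0, p.2) (1, 0) p.1
    simpa using this
  have hs : fderiv ℝ (fderiv ℝ w) p (0, 1) (1, 0) = fderiv ℝ (fderiv ℝ w) p (1, 0) (0, 1) :=
    (hw.contDiffAt.isSymmSndFDerivAt (by
      simp only [minSmoothness_of_isRCLikeNormedField]
      exact WithTop.coe_le_coe.2 (le_top : (2 : ℕ∞) ≤ ⊤))) _ _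
  have d1 : ((-1, 1) : ℝ × ℝ) = (0, 1) - (1, 0) := by simp
  have d2 : ((1, 1) : ℝ × ℝ) = (0, 1) + (1, 0) := by simp
  rw [waveOp, e1, e2, d1, d2]
  simp only [map_sub, map_add, _root_.sub_apply]
  rw [hs]; ring

lemma waveOp_sub' (u v : ℝ × ℝ → ℝ) (hu : ContDiff ℝ (⊤ : ℕ∞) u) (hv : ContDiff ℝ (⊤ : ℕ∞) v)
    (p : ℝ × ℝ) : waveOp (fun p => u p - v p) p = waveOp u p - waveOp v p := by
  rw [waveOp_eq _ (hu.sub hv), waveOp_eq _ hu, waveOp_eq _ hv]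
  have h1 : fderiv ℝ (fun p => u p - v p) = fun p => fderiv ℝ u p - fderiv ℝ v p :=
    funext fun p => fderiv_fun_sub (hu.differentiable (by simp) p) (hv.differentiable (by simp) p)
  have hu1 : ContDiff ℝ (⊤ : ℕ∞) (fderiv ℝ u) := hu.fderiv_right (by simp)
  have hv1 : ContDiff ℝ (⊤ : ℕ∞) (fderiv ℝ v) := hv.fderiv_right (by simp)
  rw [h1, fderiv_fun_sub (hu1.differentiable (by simp) p) (hv1.differentiable (by simp) p)]
  simp

/-- growth comparison along a line -/
lemma growth (g g' : ℝ → ℝ) (t A B l : ℝ) (hl : 0 < l) (hB : 0 ≤ B) (ht : 0 ≤ t)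
    (hg : ∀ s, HasDerivAt g (g' s) s)
    (hb : ∀ s ∈ Set.Icc 0 t, |g' s| ≤ A + B * Real.exp (l * s)) :
    |g t| ≤ |g 0| + A * t + B / l * Real.exp (l * t) := by
  have hB1 : ∀ s, HasDerivAt (fun s => |g 0| + A * s + B / l * Real.exp (l * s))
      (A + B * Real.exp (l * s)) s := by
    intro s
    have h1 : HasDerivAt (fun s => Real.exp (l * s)) (Real.exp (l * s) * (l * 1)) s :=
      ((hasDerivAt_id s).const_mul l).exp
    have h2 := (((hasDerivAt_id s).const_mul A).const_add |g 0|).add (h1.const_mul (B / l))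
    have hl1 : l ≠ 0 := hl.ne'
    have e : A + B * Real.exp (l * s) = A * 1 + B / l * (Real.exp (l * s) * (l * 1)) := by
      rw [show B / l * (Real.exp (l * s) * (l * 1)) = B * Real.exp (l * s) * (l / l) by ring,
        div_self hl1]
      ring
    rw [e]
    exact h2
  have := image_norm_le_of_norm_deriv_right_le_deriv_boundary (f := g) (f' := g') (a := 0) (b := t)
    (B := fun s => |g 0| + A * s + B / l * Real.exp (l * s))
    (B' := fun s => A + B * Real.exp (l * s))
    (fun s _ => (hg s).continuousAt.continuousWithinAt)
    (fun s _ => (hg s).hasDerivWithinAt)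
    (by simp; positivity) hB1
    (fun s hs => hb s ⟨hs.1, hs.2.le⟩)
  simpa using this (x := t) ⟨ht, le_rfl⟩

lemma energy_pos (w : ℝ × ℝ → ℝ) (hw : ContDiff ℝ (⊤ : ℕ∞) w) (L R A B N : ℝ)
    (hL : 0 ≤ L) (hR : 0 ≤ R) (hA : 0 ≤ A) (hB : 0 ≤ B) (hN : 0 ≤ N)
    (hpde : ∀ p : ℝ × ℝ, |p.1| + |p.2| ≤ R → |waveOp w p| ≤ L * |w p| + N)
    (h0 : ∀ x, |x| ≤ R → |w (x, 0)| ≤ A)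
    (h1 : ∀ x, |x| ≤ R → |deriv (fun y => w (y, 0)) x| ≤ B)
    (h2 : ∀ x, |x| ≤ R → |deriv (fun s => w (x, s)) 0| ≤ B)
    (x t : ℝ) (ht : 0 ≤ t) (hxt : |x| + t ≤ R) :
    |w (x, t)| ≤ 2 * Real.exp ((L + 1) * R) * (A + R * (2 * B + N * R)) := by
  set l := L + 1 with hl
  have hl0 : 0 < l := by positivity
  let D : Set (ℝ × ℝ) := {p | |p.1| + |p.2| ≤ R ∧ 0 ≤ p.2}
  have hDc : IsCompact D := by
    refine (isCompact_Icc (a := ((-R, -R) : ℝ × ℝ)) (b := (R, R))).of_isClosed_subset ?_ ?_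
    · exact (isClosed_le (f := fun p : ℝ × ℝ => |p.1| + |p.2|) (g := fun _ => R) (by fun_prop)
        (by fun_prop)).inter (isClosed_le (f := fun _ : ℝ × ℝ => (0 : ℝ)) (g := fun p => p.2)
        (by fun_prop) (by fun_prop))
    · rintro ⟨y, s⟩ ⟨h, -⟩
      simp only at h
      have := abs_nonneg y
      have := abs_nonneg s
      have hy := abs_le.1 (show |y| ≤ R by linarith)
      have hs := abs_le.1 (show |s| ≤ R by linarith)
      exact ⟨⟨hy.1, hs.1⟩, ⟨hy.2, hs.2⟩⟩
  have hDm : ((x, t) : ℝ × ℝ) ∈ D := ⟨by simpa [abs_of_nonneg ht] using hxt, ht⟩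
  have hwc := hw.continuous
  obtain ⟨m, hmD, hm⟩ := hDc.exists_isMaxOn ⟨_, hDm⟩
    (f := fun p => Real.exp (-(l * p.2)) * |w p|) (by fun_prop)
  set S := Real.exp (-(l * m.2)) * |w m| with hS
  have hS0 : 0 ≤ S := by positivity
  have hwS : ∀ p ∈ D, |w p| ≤ S * Real.exp (l * p.2) := by
    intro p hp
    have : Real.exp (-(l * p.2)) * |w p| ≤ S := hm hp
    rw [Real.exp_neg, inv_mul_le_iff₀ (Real.exp_pos _)] at this
    linarith
  -- the first-order quantity
  have hz0 : ∀ y, |y| ≤ R → |fderiv ℝ w (y, 0) (1, 1)| ≤ 2 * B := by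
    intro y hy
    have e1 : deriv (fun y => w (y, 0)) y = fderiv ℝ w (y, 0) (1, 0) := by
      have := (first_deriv_line w hw (0, 0) (1, 0) y).deriv
      simpa using this
    have e2 : deriv (fun s => w (y, s)) 0 = fderiv ℝ w (y, 0) (0, 1) := by
      have := (first_deriv_line w hw (y, 0) (0, 1) 0).deriv
      simpa using this
    have d2 : ((1, 1) : ℝ × ℝ) = (1, 0) + (0, 1) := by simp
    rw [d2, map_add, ← e1, ← e2]
    refine (abs_add_le _ _).trans ?_
    linarith [h1 y hy, h2 y hy]
  have hz : ∀ p ∈ D, |fderiv ℝ w p (1, 1)| ≤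
      (2 * B + N * R) + L * S / l * Real.exp (l * p.2) := by
    rintro ⟨y, τ⟩ ⟨hp1, hp2⟩
    simp only at hp1 hp2
    rw [abs_of_nonneg hp2] at hp1
    have ky := abs_nonneg y
    have key := growth (fun s => fderiv ℝ w ((y + τ, 0) + s • (-1, 1)) (1, 1)) _ τ N (L * S) l hl0
      (by positivity) hp2 (fun s => second_deriv_line w hw (y + τ, 0) (-1, 1) (1, 1) s) ?_
    · have e1 : ((y + τ, 0) + τ • (-1, 1) : ℝ × ℝ) = (y, τ) := by ext <;> simp
      have e0 : ((y + τ, 0) + (0:ℝ) • (-1, 1) : ℝ × ℝ) = (y + τ, 0) := by simp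
      simp only [e1, e0] at key
      have := hz0 (y + τ) (by
        have := abs_add_le y τ
        rw [abs_of_nonneg hp2] at this
        linarith)
      have : N * τ ≤ N * R := by gcongr; linarith
      simp only
      linarith
    · intro s hs
      rw [← waveOp_eq w hw]
      have hb : |y + τ - s| ≤ |y| + (τ - s) := by
        have := abs_add_le y (τ - s)
        rwa [abs_of_nonneg (show 0 ≤ τ - s by linarith [hs.2]), ← add_sub_assoc] at this
      have hD : ((y + τ, 0) + s • (-1, 1) : ℝ × ℝ) ∈ D := by
        refine ⟨?_, by simpa using hs.1⟩
        simp [abs_of_nonneg hs.1, ← sub_eq_add_neg]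
        linarith
      have q1 := hpde _ hD.1
      have q2 := hwS _ hD
      have q3 := mul_le_mul_of_nonneg_left q2 hL
      simp only [Prod.snd_add, Prod.smul_snd, smul_eq_mul, mul_one, zero_add] at q3
      linarith
  have hw2 : ∀ p ∈ D, |w p| ≤ (A + R * (2 * B + N * R)) + L * S / l / l * Real.exp (l * p.2) := by
    rintro ⟨y, τ⟩ ⟨hp1, hp2⟩
    simp only at hp1 hp2
    rw [abs_of_nonneg hp2] at hp1
    have ky := abs_nonneg y
    have key := growth (fun s => w ((y - τ, 0) + s • (1, 1))) _ τ (2 * B + N * R) (L * S / l) l hl0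
      (by positivity) hp2 (fun s => first_deriv_line w hw (y - τ, 0) (1, 1) s) ?_
    · have e1 : ((y - τ, 0) + τ • (1, 1) : ℝ × ℝ) = (y, τ) := by ext <;> simp
      have e0 : ((y - τ, 0) + (0:ℝ) • (1, 1) : ℝ × ℝ) = (y - τ, 0) := by simp
      simp only [e1, e0] at key
      have := h0 (y - τ) (by
        have := abs_sub y τ
        rw [abs_of_nonneg hp2] at this
        linarith)
      have : (2 * B + N * R) * τ ≤ (2 * B + N * R) * R := by gcongr; linarith
      simp only
      linarith
    · intro s hs
      have hb : |y - τ + s| ≤ |y| + (τ - s) := by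
        have := abs_sub y (τ - s)
        rwa [abs_of_nonneg (show 0 ≤ τ - s by linarith [hs.2]), ← sub_add] at this
      have hD : ((y - τ, 0) + s • (1, 1) : ℝ × ℝ) ∈ D := by
        refine ⟨?_, by simpa using hs.1⟩
        simp [abs_of_nonneg hs.1]
        linarith
      simpa using hz _ hD
  set Q := A + R * (2 * B + N * R) with hQ
  have hQ0 : 0 ≤ Q := by positivity
  have hS2 : S ≤ 2 * Q := by
    have := hw2 m hmD
    have h3 : S ≤ Q + L * S / l / l := by
      rw [hS, Real.exp_neg, inv_mul_le_iff₀ (Real.exp_pos _), ← Real.exp_neg, ← hS]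
      have : Q ≤ Real.exp (l * m.2) * Q := by
        have : 1 ≤ Real.exp (l * m.2) := Real.one_le_exp (mul_nonneg hl0.le hmD.2)
        nlinarith
      linarith
    have h4 : L * S / l / l ≤ S / 2 := by
      rw [div_div, div_le_div_iff₀ (by positivity) (by positivity), hl]
      nlinarith [mul_nonneg hS0 (sq_nonneg L)]
    linarith
  calc |w (x, t)| ≤ S * Real.exp (l * t) := hwS _ hDm
    _ ≤ 2 * Q * Real.exp (l * R) := by
        gcongr
        linarith [abs_nonneg x]
    _ = _ := by ring

lemma energy (w : ℝ × ℝ → ℝ) (hw : ContDiff ℝ (⊤ : ℕ∞) w) (L R A B N : ℝ)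
    (hL : 0 ≤ L) (hR : 0 ≤ R) (hA : 0 ≤ A) (hB : 0 ≤ B) (hN : 0 ≤ N)
    (hpde : ∀ p : ℝ × ℝ, |p.1| + |p.2| ≤ R → |waveOp w p| ≤ L * |w p| + N)
    (h0 : ∀ x, |x| ≤ R → |w (x, 0)| ≤ A)
    (h1 : ∀ x, |x| ≤ R → |deriv (fun y => w (y, 0)) x| ≤ B)
    (h2 : ∀ x, |x| ≤ R → |deriv (fun s => w (x, s)) 0| ≤ B)
    (x t : ℝ) (hxt : |x| + |t| ≤ R) :
    |w (x, t)| ≤ 2 * Real.exp ((L + 1) * R) * (A + R * (2 * B + N * R)) := by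
  rcases le_total 0 t with ht | ht
  · exact energy_pos w hw L R A B N hL hR hA hB hN hpde h0 h1 h2 x t ht
      (by rwa [abs_of_nonneg ht] at hxt)
  · have hw' : ContDiff ℝ (⊤ : ℕ∞) (fun p : ℝ × ℝ => w (p.1, -p.2)) := by fun_prop
    have := energy_pos (fun p : ℝ × ℝ => w (p.1, -p.2)) hw' L R A B N hL hR hA hB hN ?_
      (by simpa using h0) (by simpa using h1) ?_ x (-t) (by linarith)
      (by rwa [abs_of_nonpos ht] at hxt)
    · simpa using this
    · intro p hp
      have e : waveOp (fun p : ℝ × ℝ => w (p.1, -p.2)) p = waveOp w (p.1, -p.2) := by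
        simp only [waveOp]
        rw [iteratedDeriv_comp_neg 2 (fun s => w (p.1, s)) p.2]
        simp
      rw [e]
      exact hpde (p.1, -p.2) (by simpa using hp)
    · intro y hy
      have := deriv_comp_neg (fun s => w (y, s)) 0
      simp only at this ⊢
      rw [this]
      simpa using h2 y hy

lemma interp {E F : Type*} [NormedAddCommGroup E] [NormedSpace ℝ E] [NormedAddCommGroup F]
    [NormedSpace ℝ F] (g : E → F) (hg : ContDiff ℝ (⊤ : ℕ∞) g) (k : ℕ) (x : E) (η a M : ℝ)
    (hη : 0 < η) (ha : 0 ≤ a) (hM : 0 ≤ M)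
    (h0 : ∀ y ∈ Metric.closedBall x η, ‖iteratedFDeriv ℝ k g y‖ ≤ a)
    (h2 : ∀ y ∈ Metric.closedBall x η, ‖iteratedFDeriv ℝ (k + 2) g y‖ ≤ M) :
    ‖iteratedFDeriv ℝ (k + 1) g x‖ ≤ 2 * a / η + M * η := by
  have hd : ∀ j, Differentiable ℝ (iteratedFDeriv ℝ j g) := fun j =>
    hg.differentiable_iteratedFDeriv (by exact_mod_cast ENat.natCast_lt_top j)
  have hxm : x ∈ Metric.closedBall x η := Metric.mem_closedBall_self hη.le
  have hconv := convex_closedBall x η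
  have s1 : ∀ y ∈ Metric.closedBall x η,
      ‖fderiv ℝ (iteratedFDeriv ℝ k g) y - fderiv ℝ (iteratedFDeriv ℝ k g) x‖ ≤ M * η := by
    intro y hy
    have := hconv.norm_image_sub_le_of_norm_fderiv_le (𝕜 := ℝ) (f := iteratedFDeriv ℝ (k + 1) g)
      (fun z _ => hd _ z) (fun z hz => by rw [norm_fderiv_iteratedFDeriv]; exact h2 z hz) hxm hy
    have e := LinearIsometryEquiv.norm_map
      (continuousMultilinearCurryLeftEquiv ℝ (fun _ : Fin (k + 1) => E) F)
      (iteratedFDeriv ℝ (k + 1) g y - iteratedFDeriv ℝ (k + 1) g x)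
    refine (le_of_eq e).trans (this.trans ?_)
    gcongr
    rwa [← dist_eq_norm]
  rw [← norm_fderiv_iteratedFDeriv]
  refine ContinuousLinearMap.opNorm_le_of_unit_norm (by positivity) ?_
  intro d hd1
  have hy : x + η • d ∈ Metric.closedBall x η := by
    simp [norm_smul, hd1, abs_of_pos hη]
  have s2 := hconv.norm_image_sub_le_of_norm_fderiv_le' (𝕜 := ℝ) (f := iteratedFDeriv ℝ k g)
    (fun z _ => hd _ z) s1 hxm hy
  rw [add_sub_cancel_left, norm_smul, hd1, mul_one, Real.norm_of_nonneg hη.le, map_smul] at s2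
  set T := fderiv ℝ (iteratedFDeriv ℝ k g) x d
  set P := iteratedFDeriv ℝ k g (x + η • d)
  set Q := iteratedFDeriv ℝ k g x
  have s3 : ‖η • T‖ ≤ 2 * a + M * η * η := by
    have e : η • T = P - Q - (P - Q - η • T) := by abel
    rw [e]
    have b1 := norm_sub_le (P - Q) (P - Q - η • T)
    have b2 := norm_sub_le P Q
    have b3 := h0 _ hy
    have b4 := h0 _ hxm
    linarith
  rw [norm_smul, Real.norm_of_nonneg hη.le] at s3
  have : 2 * a / η + M * η = (2 * a + M * η * η) / η := by field_simp
  rw [this, le_div_iff₀ hη]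
  linarith

lemma null_of_zero {E : Type*} [NormedAddCommGroup E] [NormedSpace ℝ E] [ProperSpace E]
    (w : ℝ → E → ℝ) (hw : ModerateNet w)
    (h0 : ∀ K : Set E, IsCompact K → ∀ q : ℝ, 0 ≤ q → ∃ C : ℝ, 0 < C ∧ ∃ ε₀ : ℝ, 0 < ε₀ ∧
      ∀ ε ∈ Set.Ioc (0:ℝ) 1, ε ≤ ε₀ → ∀ x ∈ K, |w ε x| ≤ C * ε ^ q) : NullNet w := by
  refine ⟨hw.1, ?_⟩
  intro K hK k
  induction k generalizing K with
  | zero =>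
    intro q hq
    simpa using h0 K hK q hq
  | succ k ih =>
    intro q hq
    have hK' : IsCompact (Metric.cthickening 1 K) := hK.cthickening
    obtain ⟨p, hp, C₂, hC₂, e₂, he₂, H₂⟩ := hw.2 _ hK' (k + 2)
    obtain ⟨C₁, hC₁, e₁, he₁, H₁⟩ := ih _ hK' (2 * q + p) (by positivity)
    refine ⟨2 * C₁ + C₂, by positivity, min e₁ e₂, lt_min he₁ he₂, ?_⟩
    intro ε hε hle x hx
    have hε0 : 0 < ε := hε.1
    have hη1 : ε ^ (q + p) ≤ 1 := Real.rpow_le_one hε0.le hε.2 (by positivity)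
    have hsub : Metric.closedBall x (ε ^ (q + p)) ⊆ Metric.cthickening 1 K :=
      (Metric.closedBall_subset_closedBall hη1).trans (Metric.closedBall_subset_cthickening hx 1)
    have key := interp (w ε) (hw.1 ε hε) k x (ε ^ (q + p)) (C₁ * ε ^ (2 * q + p)) (C₂ * ε ^ (-p))
      (Real.rpow_pos_of_pos hε0 _) (by positivity) (by positivity)
      (fun y hy => H₁ ε hε (hle.trans (min_le_left _ _)) y (hsub hy))
      (fun y hy => H₂ ε hε (hle.trans (min_le_right _ _)) y (hsub hy))
    refine key.trans (le_of_eq ?_)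
    have r1 : ε ^ (2 * q + p) = ε ^ q * ε ^ (q + p) := by
      rw [← Real.rpow_add hε0]; ring_nf
    have r2 : ε ^ (-p) * ε ^ (q + p) = ε ^ q := by
      rw [← Real.rpow_add hε0]; ring_nf
    have hpos : ε ^ (q + p) ≠ 0 := (Real.rpow_pos_of_pos hε0 _).ne'
    rw [mul_assoc C₂, r2, r1]
    rw [show 2 * (C₁ * (ε ^ q * ε ^ (q + p))) / ε ^ (q + p)
      = 2 * C₁ * ε ^ q * (ε ^ (q + p) / ε ^ (q + p)) by ring, div_self hpos]
    ring

lemma moderate_sub {E : Type*} [NormedAddCommGroup E] [NormedSpace ℝ E]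
    (u v : ℝ → E → ℝ) (hu : ModerateNet u) (hv : ModerateNet v) :
    ModerateNet (fun ε p => u ε p - v ε p) := by
  refine ⟨fun ε hε => (hu.1 ε hε).sub (hv.1 ε hε), ?_⟩
  intro K hK k
  obtain ⟨p, hp, C₁, hC₁, e₁, he₁, H₁⟩ := hu.2 K hK k
  obtain ⟨r, hr, C₂, hC₂, e₂, he₂, H₂⟩ := hv.2 K hK k
  refine ⟨p + r, by positivity, C₁ + C₂, by positivity, min e₁ e₂, lt_min he₁ he₂, ?_⟩
  intro ε hε hle x hx
  have hk : ((k : ℕ∞) : WithTop ℕ∞) ≤ ((⊤ : ℕ∞) : WithTop ℕ∞) := WithTop.coe_le_coe.2 le_top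
  rw [fun_iteratedFDeriv_sub_apply ((hu.1 ε hε).of_le hk).contDiffAt
    ((hv.1 ε hε).of_le hk).contDiffAt]
  refine (norm_sub_le _ _).trans ?_
  have b1 := H₁ ε hε (hle.trans (min_le_left _ _)) x hx
  have b2 := H₂ ε hε (hle.trans (min_le_right _ _)) x hx
  have c1 : ε ^ (-p) ≤ ε ^ (-(p + r)) := Real.rpow_le_rpow_of_exponent_ge hε.1 hε.2 (by linarith)
  have c2 : ε ^ (-r) ≤ ε ^ (-(p + r)) := Real.rpow_le_rpow_of_exponent_ge hε.1 hε.2 (by linarith)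
  have d1 := mul_le_mul_of_nonneg_left c1 hC₁.le
  have d2 := mul_le_mul_of_nonneg_left c2 hC₂.le
  linarith

/-- Uniqueness part of Colombeau solvability: two moderate nets solving the
semilinear wave equation with data differing by null nets differ by a null net. -/
theorem semilinear_wave_unique
    (f : ℝ → ℝ) (hf : Admissible f)
    (a b : ℝ → ℝ → ℝ) (h : ℝ → ℝ × ℝ → ℝ)
    (ha : ∀ ε ∈ Set.Ioc (0:ℝ) 1, ContDiff ℝ (⊤ : ℕ∞) (a ε))
    (hb : ∀ ε ∈ Set.Ioc (0:ℝ) 1, ContDiff ℝ (⊤ : ℕ∞) (b ε))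
    (hh : ∀ ε ∈ Set.Ioc (0:ℝ) 1, ContDiff ℝ (⊤ : ℕ∞) (h ε))
    (n0 n1 : ℝ → ℝ → ℝ) (nn : ℝ → ℝ × ℝ → ℝ)
    (hn0 : NullNet n0) (hn1 : NullNet n1) (hnn : NullNet nn)
    (u v : ℝ → ℝ × ℝ → ℝ)
    (hu : ModerateNet u) (hv : ModerateNet v)
    (hupde : ∀ ε ∈ Set.Ioc (0:ℝ) 1, ∀ p : ℝ × ℝ, waveOp (u ε) p = f (u ε p) + h ε p)
    (huinit0 : ∀ ε ∈ Set.Ioc (0:ℝ) 1, ∀ x : ℝ, u ε (x, 0) = a ε x)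
    (huinit1 : ∀ ε ∈ Set.Ioc (0:ℝ) 1, ∀ x : ℝ, deriv (fun s => u ε (x, s)) 0 = b ε x)
    (hvpde : ∀ ε ∈ Set.Ioc (0:ℝ) 1, ∀ p : ℝ × ℝ,
      waveOp (v ε) p = f (v ε p) + h ε p + nn ε p)
    (hvinit0 : ∀ ε ∈ Set.Ioc (0:ℝ) 1, ∀ x : ℝ, v ε (x, 0) = a ε x + n0 ε x)
    (hvinit1 : ∀ ε ∈ Set.Ioc (0:ℝ) 1, ∀ x : ℝ,
      deriv (fun s => v ε (x, s)) 0 = b ε x + n1 ε x) :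
    NullNet (fun ε p => u ε p - v ε p) := by
  have hmod := moderate_sub u v hu hv
  refine null_of_zero _ hmod ?_
  intro K hK q hq
  obtain ⟨hfs, -, ⟨L, hL⟩, -⟩ := hf
  have hL0 : 0 ≤ L := (abs_nonneg _).trans (hL 0)
  have hlip : ∀ y z : ℝ, |f y - f z| ≤ L * |y - z| := by
    intro y z
    exact convex_univ.norm_image_sub_le_of_norm_deriv_le (𝕜 := ℝ)
      (fun x _ => hfs.differentiable (by simp) x) (fun x _ => hL x) (mem_univ z) (mem_univ y)
  obtain ⟨r, hr⟩ := hK.isBounded.subset_closedBall (0 : ℝ × ℝ)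
  set R := 2 * |r| with hRdef
  have hR : 0 ≤ R := by positivity
  have hI : IsCompact (Set.Icc (-R) R) := isCompact_Icc
  have hI2 : IsCompact (Set.Icc (-R) R ×ˢ Set.Icc (-R) R) := hI.prod hI
  obtain ⟨A, hA, e₁, he₁, H₁⟩ := hn0.2 _ hI 0 q hq
  obtain ⟨B₁, hB₁, e₂, he₂, H₂⟩ := hn0.2 _ hI 1 q hq
  obtain ⟨B₂, hB₂, e₃, he₃, H₃⟩ := hn1.2 _ hI 0 q hq
  obtain ⟨N, hN, e₄, he₄, H₄⟩ := hnn.2 _ hI2 0 q hq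
  refine ⟨2 * Real.exp ((L + 1) * R) * (A + R * (2 * (B₁ + B₂) + N * R)), by positivity,
    min (min e₁ e₂) (min e₃ e₄), by positivity, ?_⟩
  intro ε hε hle p hp
  have l1 : ε ≤ e₁ := hle.trans ((min_le_left _ _).trans (min_le_left _ _))
  have l2 : ε ≤ e₂ := hle.trans ((min_le_left _ _).trans (min_le_right _ _))
  have l3 : ε ≤ e₃ := hle.trans ((min_le_right _ _).trans (min_le_left _ _))
  have l4 : ε ≤ e₄ := hle.trans ((min_le_right _ _).trans (min_le_right _ _))
  have hεq : 0 ≤ ε ^ q := Real.rpow_nonneg hε.1.le q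
  have hus := hu.1 ε hε
  have hvs := hv.1 ε hε
  have hp1 : |p.1| + |p.2| ≤ R := by
    have h1 : ‖p‖ ≤ r := by simpa using hr hp
    have h2 : |p.1| ≤ ‖p‖ := norm_fst_le p
    have h3 : |p.2| ≤ ‖p‖ := norm_snd_le p
    linarith [le_abs_self r]
  have key := energy (fun p => u ε p - v ε p) (hus.sub hvs) L R (A * ε ^ q) ((B₁ + B₂) * ε ^ q)
    (N * ε ^ q) hL0 hR (by positivity) (by positivity) (by positivity) ?_ ?_ ?_ ?_ p.1 p.2 hp1
  · refine key.trans (le_of_eq ?_)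
    ring
  · intro z hz
    have hz1 : z ∈ Set.Icc (-R) R ×ˢ Set.Icc (-R) R :=
      ⟨abs_le.1 (by linarith [abs_nonneg z.2]), abs_le.1 (by linarith [abs_nonneg z.1])⟩
    have hnz := H₄ ε hε l4 z hz1
    rw [norm_iteratedFDeriv_zero, Real.norm_eq_abs] at hnz
    rw [waveOp_sub' _ _ hus hvs, hupde ε hε, hvpde ε hε]
    have e : f (u ε z) + h ε z - (f (v ε z) + h ε z + nn ε z)
      = (f (u ε z) - f (v ε z)) - nn ε z := by ring
    rw [e]
    refine (abs_sub _ _).trans ?_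
    exact add_le_add (hlip _ _) hnz
  · intro x hx
    have hnz := H₁ ε hε l1 x (abs_le.1 hx)
    rw [norm_iteratedFDeriv_zero, Real.norm_eq_abs] at hnz
    simp only [huinit0 ε hε, hvinit0 ε hε]
    rwa [sub_add_cancel_left, abs_neg]
  · intro x hx
    have hnz := H₂ ε hε l2 x (abs_le.1 hx)
    rw [norm_iteratedFDeriv_eq_norm_iteratedDeriv, iteratedDeriv_one, Real.norm_eq_abs] at hnz
    have e : (fun y => u ε (y, 0) - v ε (y, 0)) = fun y => - n0 ε y := by
      funext y
      rw [huinit0 ε hε, hvinit0 ε hε]; ring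
    simp only [e]
    rw [deriv.fun_neg, abs_neg]
    have := mul_nonneg hB₂.le hεq
    linarith
  · intro x hx
    have hnz := H₃ ε hε l3 x (abs_le.1 hx)
    rw [norm_iteratedFDeriv_zero, Real.norm_eq_abs] at hnz
    have du : DifferentiableAt ℝ (fun s => u ε (x, s)) 0 :=
      ((hus.comp (contDiff_prodMk_right x)).differentiable (by simp)) 0
    have dv : DifferentiableAt ℝ (fun s => v ε (x, s)) 0 :=
      ((hvs.comp (contDiff_prodMk_right x)).differentiable (by simp)) 0
    rw [deriv_fun_sub du dv, huinit1 ε hε, hvinit1 ε hε, sub_add_cancel_left, abs_neg]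
    have := mul_nonneg hB₁.le hεq
    linarith
end
end

section
/- Let f : ℝ → ℝ be admissible, let Σ = {(x,t) : t ≥ 0, |x| ≤ t}, and let M_ε ∈ ℝ with M_ε → m ∈ ℝ as ε → 0. Let r_{0ε}, r_{1ε} be smooth functions on ℝ converging in L¹_loc(ℝ) to functions r_0, r_1 as ε → 0. For each ε let w_ε ∈ C(ℝ×[0,∞)) satisfy w_ε(x,t) = ½(r_{0ε}(x−t) + r_{0ε}(x+t)) + ½∫_{x−t}^{x+t} r_{1ε}(y)dy + ½∫_0^t∫_{x−t+s}^{x+t−s} f(M_ε 𝟙_Σ(y,s) + w_ε(y,s)) dy ds, and let w ∈ L¹_loc(ℝ×[0,∞)) satisfy (for almost every (x,t)) w(x,t) = ½(r_0(x−t) + r_0(x+t)) + ½∫_{x−t}^{x+t} r_1(y)dy + ½∫_0^t∫_{x−t+s}^{x+t−s} f(m 𝟙_Σ(y,s) + w(y,s)) dy ds. Then for every κ > 0 and 0 ≤ T ≤ κ, ∫_{K_T} |w_ε − w| dx dt → 0 as ε → 0. -/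
open Real Set Filter MeasureTheory Topology

noncomputable section

/-- The trapezoidal domain of dependence `K_T` over the base `[-κ,κ]`. -/
def KT (κ T : ℝ) : Set (ℝ × ℝ) :=
  {p : ℝ × ℝ | 0 ≤ p.2 ∧ p.2 ≤ T ∧ |p.1| ≤ κ - p.2}

/-- The characteristic function of the solid forward light-cone
`Σ = {(y,s) : s ≥ 0, |y| ≤ s}`. -/
def indSigma (y s : ℝ) : ℝ := if 0 ≤ s ∧ |y| ≤ s then 1 else 0

open scoped ENNReal NNReal

/-- The (half-open) backward characteristic triangle with vertex `p`. -/
def Tri (p : ℝ × ℝ) : Set (ℝ × ℝ) :=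
  {q | q.2 ∈ Ioc 0 p.2 ∧ q.1 ∈ Ioc (p.1 - p.2 + q.2) (p.1 + p.2 - q.2)}

lemma measurableSet_TriGraph : MeasurableSet {z : (ℝ × ℝ) × (ℝ × ℝ) | z.2 ∈ Tri z.1} := by
  have : {z : (ℝ × ℝ) × (ℝ × ℝ) | z.2 ∈ Tri z.1} =
      (({z | 0 < z.2.2} ∩ {z | z.2.2 ≤ z.1.2}) ∩
      ({z | z.1.1 - z.1.2 + z.2.2 < z.2.1} ∩ {z | z.2.1 ≤ z.1.1 + z.1.2 - z.2.2})) := by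
    ext z; simp [Tri]
  rw [this]
  refine ((measurableSet_lt ?_ ?_).inter (measurableSet_le ?_ ?_)).inter
    ((measurableSet_lt ?_ ?_).inter (measurableSet_le ?_ ?_)) <;> fun_prop

lemma measurableSet_Tri (p : ℝ × ℝ) : MeasurableSet (Tri p) :=
  measurableSet_TriGraph.preimage (measurable_prodMk_left (x := p))

lemma isCompact_KT (κ T : ℝ) : IsCompact (KT κ T) := by
  refine IsCompact.of_isClosed_subset
    (isCompact_Icc.prod isCompact_Icc : IsCompact (Icc (-κ) κ ×ˢ Icc 0 T)) ?_ ?_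
  · have : KT κ T = {p | 0 ≤ p.2} ∩ ({p | p.2 ≤ T} ∩ {p | |p.1| ≤ κ - p.2}) := by
      ext; simp [KT]
    rw [this]
    refine (isClosed_le ?_ ?_).inter ((isClosed_le ?_ ?_).inter (isClosed_le ?_ ?_)) <;> fun_prop
  · rintro ⟨x, t⟩ ⟨h1, h2, h3⟩
    simp only at h1 h2 h3
    rw [abs_le] at h3
    simp only [mem_prod, mem_Icc]
    refine ⟨⟨?_, ?_⟩, ?_, ?_⟩ <;> linarith

lemma Tri_subset_KT {κ T : ℝ} {p : ℝ × ℝ} (hp : p ∈ KT κ T) : Tri p ⊆ KT κ T := by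
  obtain ⟨x, t⟩ := p
  rintro ⟨y, s⟩ ⟨⟨h1, h2⟩, h3, h4⟩
  obtain ⟨k1, k2, k3⟩ := hp
  simp only at *
  rw [abs_le] at k3
  refine ⟨h1.le, by simp only; linarith, ?_⟩
  simp only
  rw [abs_le]
  constructor <;> linarith

lemma tri_integral {F : ℝ × ℝ → ℝ} {x t : ℝ} (ht : 0 ≤ t) (hF : IntegrableOn F (Tri (x, t))) :
    (∫ s in (0:ℝ)..t, ∫ y in (x - t + s)..(x + t - s), F (y, s)) = ∫ q in Tri (x, t), F q := by
  have hm := measurableSet_Tri (x, t)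
  rw [← integral_indicator hm]
  have hI : Integrable ((Tri (x, t)).indicator F) (volume : Measure (ℝ × ℝ)) :=
    hF.integrable_indicator hm
  rw [Measure.volume_eq_prod] at hI ⊢
  rw [integral_prod_symm _ hI, intervalIntegral.integral_of_le ht,
    ← integral_indicator measurableSet_Ioc]
  refine integral_congr_ae (Eventually.of_forall fun s => ?_)
  by_cases hs : s ∈ Ioc 0 t
  · simp only [indicator_of_mem hs]
    have : x - t + s ≤ x + t - s := by linarith [hs.2]
    rw [intervalIntegral.integral_of_le this, ← integral_indicator measurableSet_Ioc]
    refine integral_congr_ae (Eventually.of_forall fun y => ?_)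
    by_cases hy : y ∈ Ioc (x - t + s) (x + t - s)
    · have : (y, s) ∈ Tri (x, t) := ⟨hs, hy⟩
      simp only [indicator_of_mem hy, indicator_of_mem this]
    · have : (y, s) ∉ Tri (x, t) := fun h => hy h.2
      simp only [indicator_of_notMem hy, indicator_of_notMem this]
  · simp only [indicator_of_notMem hs]
    have : ∀ y, (Tri (x, t)).indicator F (y, s) = 0 := fun y =>
      indicator_of_notMem (fun h => hs h.1) _
    simp [this]

lemma lintegral_exp_Ioi {l : ℝ} (hl : 0 < l) (s : ℝ) :
    ∫⁻ t in Ioi s, ENNReal.ofReal (Real.exp (-l * t)) = ENNReal.ofReal (Real.exp (-l * s) / l) := by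
  rw [← ofReal_integral_eq_lintegral_ofReal]
  · rw [integral_exp_mul_Ioi (by linarith)]
    congr 1
    field_simp
  · exact integrableOn_exp_mul_Ioi (by linarith) s
  · exact Eventually.of_forall fun t => (Real.exp_pos _).le

/-- Gronwall-type estimate via an exponentially weighted norm. -/
lemma weighted_gronwall {κ T : ℝ} (hκ : 0 < κ) (hT : T ≤ κ) (L : ℝ≥0) {l : ℝ} (hl : 0 < l)
    (hlL : 4 * κ * L ≤ l)
    (U A : ℝ × ℝ → ℝ≥0∞) (hU : AEMeasurable U (volume.restrict (KT κ T)))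
    (hfin : ∫⁻ p in KT κ T, U p ≠ ∞)
    (hineq : ∀ᵐ p ∂(volume.restrict (KT κ T)), U p ≤ A p + ∫⁻ q in Tri p, L * U q) :
    ∫⁻ p in KT κ T, U p ≤ ENNReal.ofReal (Real.exp (l * κ)) * (2 * ∫⁻ p in KT κ T, A p) := by
  set K := KT κ T with hK
  have hKm : MeasurableSet K := (isCompact_KT κ T).measurableSet
  set μ : Measure (ℝ × ℝ) := volume.restrict K with hμ
  let g : ℝ × ℝ → ℝ≥0∞ := fun p => ENNReal.ofReal (Real.exp (-l * p.2))
  have hg : Measurable g := by fun_prop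
  have hg1 : ∀ p ∈ K, g p ≤ 1 := by
    rintro p ⟨h1, -, -⟩
    refine ENNReal.ofReal_le_one.2 (Real.exp_le_one_iff.2 ?_)
    nlinarith
  let H : ℝ × ℝ → ℝ × ℝ → ℝ≥0∞ := fun p q =>
    {z : (ℝ × ℝ) × (ℝ × ℝ) | z.2 ∈ Tri z.1}.indicator (fun _ => 1) (p, q)
  have hH : Measurable (Function.uncurry H) :=
    measurable_const.indicator measurableSet_TriGraph
  have hHm : AEMeasurable (Function.uncurry fun p q => g p * H p q * (L * U q)) (μ.prod μ) := by
    refine ((hg.comp measurable_fst).mul hH).aemeasurable.mul ?_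
    exact (hU.const_mul _).comp_snd
  -- the inner kernel bound
  have hker : ∀ q, ∫⁻ p, g p * H p q ∂μ ≤ ENNReal.ofReal (2 * κ / l) * g q := by
    intro q
    calc ∫⁻ p, g p * H p q ∂μ
        = ∫⁻ p, K.indicator (fun p => g p * H p q) p := by rw [lintegral_indicator hKm]
      _ ≤ ∫⁻ p : ℝ × ℝ, (Icc (-κ) κ).indicator (fun _ => 1) p.1 *
            (Ici q.2).indicator (fun t => ENNReal.ofReal (Real.exp (-l * t))) p.2 := by
          refine lintegral_mono fun p => ?_
          by_cases hp : p ∈ K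
          · rw [indicator_of_mem hp]
            by_cases hq : q ∈ Tri p
            · have h1 : p.1 ∈ Icc (-κ) κ := by
                obtain ⟨k1, k2, k3⟩ := hp
                rw [abs_le] at k3
                constructor <;> linarith
              have h2 : p.2 ∈ Ici q.2 := hq.1.2
              have h3 : H p q = 1 := indicator_of_mem (by exact hq) _
              rw [indicator_of_mem h1, indicator_of_mem h2, h3]
              simp [g]
            · have h3 : H p q = 0 := indicator_of_notMem (by exact hq) _
              simp [h3]
          · rw [indicator_of_notMem hp]; exact zero_le
      _ = (∫⁻ x, (Icc (-κ) κ).indicator (fun _ => 1) x) *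
            ∫⁻ t, (Ici q.2).indicator (fun t => ENNReal.ofReal (Real.exp (-l * t))) t := by
          rw [Measure.volume_eq_prod]
          refine lintegral_prod_mul ?_ ?_
          · exact (measurable_const.indicator measurableSet_Icc).aemeasurable
          · refine (Measurable.indicator ?_ measurableSet_Ici).aemeasurable
            fun_prop
      _ = ENNReal.ofReal (2 * κ) * ENNReal.ofReal (Real.exp (-l * q.2) / l) := by
          rw [lintegral_indicator measurableSet_Icc, lintegral_indicator measurableSet_Ici,
            setLIntegral_congr Ioi_ae_eq_Ici.symm, lintegral_exp_Ioi hl]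
          simp only [lintegral_const, Measure.restrict_apply_univ, Real.volume_Icc, one_mul]
          congr 2; ring
      _ = ENNReal.ofReal (2 * κ / l) * g q := by
          simp only [g]
          rw [← ENNReal.ofReal_mul (by positivity), ← ENNReal.ofReal_mul (by positivity)]
          congr 1; ring
  have hhalf : ENNReal.ofReal (2 * κ / l) * L ≤ 2⁻¹ := by
    have e : (2⁻¹ : ℝ≥0∞) = ENNReal.ofReal (1/2) := by
      rw [one_div, ENNReal.ofReal_inv_of_pos (by norm_num)]; norm_num
    rw [e, ← ENNReal.ofReal_coe_nnreal, ← ENNReal.ofReal_mul (by positivity)]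
    refine ENNReal.ofReal_le_ofReal ?_
    rw [div_mul_eq_mul_div, div_le_iff₀ hl]; linarith
  set N := ∫⁻ p, g p * U p ∂μ with hN
  have hNfin : N ≠ ∞ := by
    refine ne_top_of_le_ne_top hfin (setLIntegral_mono_ae' hKm (Eventually.of_forall ?_))
    intro p hp
    calc g p * U p ≤ 1 * U p := by gcongr; exact hg1 p hp
      _ = U p := one_mul _
  have hmain : N ≤ ∫⁻ p, A p ∂μ + 2⁻¹ * N := by
    calc N ≤ ∫⁻ p, (A p + ∫⁻ q, g p * H p q * (L * U q) ∂μ) ∂μ := by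
          have hmem : ∀ᵐ p ∂μ, p ∈ K := ae_restrict_mem hKm
          refine lintegral_mono_ae ?_
          filter_upwards [hineq, hmem] with p hp hpK
          calc g p * U p ≤ g p * (A p + ∫⁻ q in Tri p, L * U q) := by gcongr
            _ = g p * A p + g p * ∫⁻ q in Tri p, L * U q := mul_add _ _ _
            _ ≤ A p + ∫⁻ q, g p * H p q * (L * U q) ∂μ := by
              refine add_le_add ?_ ?_
              · calc g p * A p ≤ 1 * A p := by gcongr; exact hg1 p hpK
                  _ = A p := one_mul _
              · rw [← lintegral_const_mul' _ _ ENNReal.ofReal_ne_top,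
                  ← lintegral_indicator (measurableSet_Tri p), hμ, ← lintegral_indicator hKm]
                refine lintegral_mono fun q => ?_
                by_cases hq : q ∈ Tri p
                · have h3 : H p q = 1 := indicator_of_mem (by exact hq) _
                  rw [indicator_of_mem hq, indicator_of_mem (Tri_subset_KT hpK hq), h3, mul_one]
                · rw [indicator_of_notMem hq]; exact zero_le
      _ = ∫⁻ p, A p ∂μ + ∫⁻ p, ∫⁻ q, g p * H p q * (L * U q) ∂μ ∂μ :=
          lintegral_add_right' _ hHm.lintegral_prod_right'
      _ = ∫⁻ p, A p ∂μ + ∫⁻ q, ∫⁻ p, g p * H p q * (L * U q) ∂μ ∂μ := by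
          rw [lintegral_lintegral_swap hHm]
      _ ≤ ∫⁻ p, A p ∂μ + ∫⁻ q, 2⁻¹ * (g q * U q) ∂μ := by
          gcongr with q
          have hmq : Measurable fun p => g p * H p q :=
            hg.mul (hH.comp (measurable_prodMk_right (y := q)))
          rw [lintegral_mul_const _ hmq]
          calc (∫⁻ p, g p * H p q ∂μ) * (L * U q)
              ≤ (ENNReal.ofReal (2 * κ / l) * g q) * (L * U q) := by gcongr; exact hker q
            _ = (ENNReal.ofReal (2 * κ / l) * L) * (g q * U q) := by ring
            _ ≤ _ := by gcongr
      _ = _ := by rw [lintegral_const_mul' _ _ (by simp)]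
  have hN2 : N ≤ 2 * ∫⁻ p, A p ∂μ := by
    have h1 : 2⁻¹ * N + 2⁻¹ * N ≤ ∫⁻ p, A p ∂μ + 2⁻¹ * N := by
      rw [← add_mul, ENNReal.inv_two_add_inv_two, one_mul]; exact hmain
    have h2 : 2⁻¹ * N ≤ ∫⁻ p, A p ∂μ :=
      (ENNReal.add_le_add_iff_right (ENNReal.mul_ne_top (by simp) hNfin)).1 h1
    calc N = 2 * (2⁻¹ * N) := by
          rw [← mul_assoc, ENNReal.mul_inv_cancel (by simp) (by simp), one_mul]
      _ ≤ _ := by gcongr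
  calc ∫⁻ p, U p ∂μ ≤ ∫⁻ p, ENNReal.ofReal (Real.exp (l * κ)) * (g p * U p) ∂μ := by
        refine setLIntegral_mono_ae' hKm (Eventually.of_forall ?_)
        rintro p ⟨h1, h2, h3⟩
        rw [← mul_assoc]
        have : 1 ≤ ENNReal.ofReal (Real.exp (l * κ)) * g p := by
          simp only [g]
          rw [← ENNReal.ofReal_mul (by positivity), ← Real.exp_add, ENNReal.one_le_ofReal,
            Real.one_le_exp_iff]
          nlinarith
        calc U p = 1 * U p := (one_mul _).symm
          _ ≤ _ := by gcongr
    _ = ENNReal.ofReal (Real.exp (l * κ)) * N := lintegral_const_mul' _ _ ENNReal.ofReal_ne_top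
    _ ≤ _ := by gcongr

lemma exists_measurable_ge_ae_eq {D : ℝ → ℝ≥0∞} (hD : AEMeasurable D) :
    ∃ D' : ℝ → ℝ≥0∞, Measurable D' ∧ (∀ x, D x ≤ D' x) ∧ D =ᵐ[volume] D' := by
  obtain ⟨D₁, hm, he⟩ := hD
  set N := toMeasurable volume {x | ¬ D x = D₁ x} with hN
  have hNm : MeasurableSet N := measurableSet_toMeasurable _ _
  have hN0 : volume N = 0 := by rw [hN, measure_toMeasurable]; exact he
  refine ⟨fun x => D₁ x + N.indicator (fun _ => ∞) x, hm.add (measurable_const.indicator hNm),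
    fun x => ?_, ?_⟩
  · by_cases hx : x ∈ N
    · simp [hx]
    · have : D x = D₁ x := by
        by_contra h
        exact hx (subset_toMeasurable _ _ h)
      simp [hx, this]
  · have hx' : ∀ᵐ x, x ∉ N := measure_eq_zero_iff_ae_notMem.1 hN0
    filter_upwards [he, hx'] with x h1 h2
    simp [h1, h2]

lemma lintegral_shift {κ T : ℝ} (hT : T ≤ κ) {D : ℝ → ℝ≥0∞} (hD : Measurable D) (c : ℝ)
    (hc : |c| ≤ 1) :
    ∫⁻ p in KT κ T, D (p.1 + c * p.2) ≤ ENNReal.ofReal κ * ∫⁻ x in Icc (-κ) κ, D x := by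
  have hKm : MeasurableSet (KT κ T) := (isCompact_KT κ T).measurableSet
  have hG : Measurable ((Icc (-κ) κ).indicator D) := hD.indicator measurableSet_Icc
  calc ∫⁻ p in KT κ T, D (p.1 + c * p.2)
      = ∫⁻ p, (KT κ T).indicator (fun p => D (p.1 + c * p.2)) p := by rw [lintegral_indicator hKm]
    _ ≤ ∫⁻ p : ℝ × ℝ, (Icc (-κ) κ).indicator D (p.1 + c * p.2) *
          (Icc 0 κ).indicator (fun _ => 1) p.2 := by
        refine lintegral_mono fun p => ?_
        by_cases hp : p ∈ KT κ T
        · rw [indicator_of_mem hp]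
          obtain ⟨h1, h2, h3⟩ := hp
          have h5 : |p.1 + c * p.2| ≤ κ := by
            calc |p.1 + c * p.2| ≤ |p.1| + |c * p.2| := abs_add_le _ _
              _ = |p.1| + |c| * p.2 := by rw [abs_mul, abs_of_nonneg h1]
              _ ≤ |p.1| + 1 * p.2 := by gcongr
              _ ≤ κ := by linarith
          have h6 : p.1 + c * p.2 ∈ Icc (-κ) κ := abs_le.1 h5
          have h4 : p.2 ∈ Icc 0 κ := ⟨h1, h2.trans hT⟩
          simp [indicator_of_mem h6, indicator_of_mem h4]
        · rw [indicator_of_notMem hp]; exact zero_le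
    _ = ∫⁻ t : ℝ, ∫⁻ x : ℝ, (Icc (-κ) κ).indicator D (x + c * t) *
          (Icc 0 κ).indicator (fun _ => 1) t := by
        rw [Measure.volume_eq_prod]
        refine lintegral_prod_symm _ (Measurable.aemeasurable ?_)
        refine (hG.comp (by fun_prop)).mul ?_
        exact (measurable_const.indicator measurableSet_Icc).comp measurable_snd
    _ = ∫⁻ t : ℝ, (∫⁻ x in Icc (-κ) κ, D x) * (Icc 0 κ).indicator (fun _ => 1) t := by
        refine lintegral_congr fun t => ?_
        have hm1 : Measurable fun x => (Icc (-κ) κ).indicator D (x + c * t) := hG.comp (by fun_prop)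
        rw [lintegral_mul_const _ hm1,
          lintegral_add_right_eq_self ((Icc (-κ) κ).indicator D), lintegral_indicator measurableSet_Icc]
    _ = ENNReal.ofReal κ * ∫⁻ x in Icc (-κ) κ, D x := by
        rw [lintegral_const_mul _ (measurable_const.indicator measurableSet_Icc),
          lintegral_indicator measurableSet_Icc]
        simp [mul_comm]

lemma measurable_indSigma : Measurable fun q : ℝ × ℝ => indSigma q.1 q.2 := by
  unfold indSigma
  refine Measurable.ite ?_ measurable_const measurable_const
  refine MeasurableSet.inter (s₁ := {q : ℝ × ℝ | 0 ≤ q.2}) (s₂ := {q : ℝ × ℝ | |q.1| ≤ q.2})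
    (measurableSet_le ?_ ?_) (measurableSet_le ?_ ?_) <;> fun_prop

lemma abs_indSigma_le (y s : ℝ) : |indSigma y s| ≤ 1 := by
  unfold indSigma; split_ifs <;> simp

lemma admissible_lipschitz {f : ℝ → ℝ} (hf : Admissible f) : ∃ L : ℝ≥0, LipschitzWith L f := by
  obtain ⟨h1, -, ⟨L, hL⟩, -⟩ := hf
  refine ⟨L.toNNReal, lipschitzWith_of_nnnorm_deriv_le (h1.differentiable (by simp)) fun x => ?_⟩
  rw [← NNReal.coe_le_coe, coe_nnnorm, Real.norm_eq_abs]
  exact (hL x).trans (Real.le_coe_toNNReal L)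

lemma integrableOn_nonlin {f : ℝ → ℝ} {L : ℝ≥0} (hL : LipschitzWith L f) (h0 : f 0 = 0) (c : ℝ)
    {K : Set (ℝ × ℝ)} (hK : IsCompact K) {V : ℝ × ℝ → ℝ} (hV : IntegrableOn V K) :
    IntegrableOn (fun q => f (c * indSigma q.1 q.2 + V q)) K := by
  have hind : IntegrableOn (fun q : ℝ × ℝ => c * indSigma q.1 q.2) K := by
    refine Integrable.const_mul ?_ c
    refine Integrable.mono' (g := fun _ => (1:ℝ)) ?_ measurable_indSigma.aestronglyMeasurable ?_
    · exact integrableOn_const hK.measure_lt_top.ne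
    · exact Eventually.of_forall fun q => abs_indSigma_le _ _
  have hs := hind.add hV
  refine Integrable.mono' (hs.norm.const_mul (L : ℝ))
    (hL.continuous.comp_aestronglyMeasurable hs.aestronglyMeasurable)
    (Eventually.of_forall fun q => ?_)
  have := hL.dist_le_mul (c * indSigma q.1 q.2 + V q) 0
  rw [h0, dist_zero_right, dist_zero_right] at this
  exact this

lemma enorm_half_sum (a b c e : ℝ) :
    ‖(1/2) * (a + b) + (1/2) * c + (1/2) * e‖ₑ ≤ ‖a‖ₑ + ‖b‖ₑ + ‖c‖ₑ + ‖e‖ₑ := by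
  simp only [← ofReal_norm, Real.norm_eq_abs]
  rw [← ENNReal.ofReal_add (by positivity) (by positivity),
    ← ENNReal.ofReal_add (by positivity) (by positivity),
    ← ENNReal.ofReal_add (by positivity) (by positivity)]
  refine ENNReal.ofReal_le_ofReal ?_
  rw [abs_le]
  constructor <;> linarith [le_abs_self a, neg_abs_le a, le_abs_self b, neg_abs_le b,
    le_abs_self c, neg_abs_le c, le_abs_self e, neg_abs_le e]

/-- The quantitative stability estimate for fixed data. -/
lemma stability_estimate {f : ℝ → ℝ} {L : ℝ≥0} (hL : LipschitzWith L f) (h0 : f 0 = 0)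
    {κ T l : ℝ} (hκ : 0 < κ) (hT : T ≤ κ) (hl : 0 < l) (hlL : 4 * κ * L ≤ l)
    (μ m : ℝ) (r0 r1 R0 R1 : ℝ → ℝ) (hr0 : LocallyIntegrable r0) (hr1 : LocallyIntegrable r1)
    (hR0 : LocallyIntegrable R0) (hR1 : LocallyIntegrable R1)
    (v W : ℝ × ℝ → ℝ) (hv : IntegrableOn v (KT κ T)) (hW : IntegrableOn W (KT κ T))
    (hveq : ∀ x t : ℝ, 0 ≤ t →
      v (x, t) = (1/2) * (r0 (x - t) + r0 (x + t))
        + (1/2) * (∫ y in (x - t)..(x + t), r1 y)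
        + (1/2) * ∫ s in (0:ℝ)..t, ∫ y in (x - t + s)..(x + t - s),
            f (μ * indSigma y s + v (y, s)))
    (hWeq : ∀ᵐ p : ℝ × ℝ, 0 ≤ p.2 →
      W p = (1/2) * (R0 (p.1 - p.2) + R0 (p.1 + p.2))
        + (1/2) * (∫ y in (p.1 - p.2)..(p.1 + p.2), R1 y)
        + (1/2) * ∫ s in (0:ℝ)..p.2, ∫ y in (p.1 - p.2 + s)..(p.1 + p.2 - s),
            f (m * indSigma y s + W (y, s))) :
    ∫⁻ p in KT κ T, ‖v p - W p‖ₑ ≤ ENNReal.ofReal (Real.exp (l * κ)) * (2 *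
      (2 * (ENNReal.ofReal κ * ∫⁻ x in Icc (-κ) κ, ‖r0 x - R0 x‖ₑ) +
        ((∫⁻ x in Icc (-κ) κ, ‖r1 x - R1 x‖ₑ) + L * ‖μ - m‖ₑ * volume (KT κ T)) *
          volume (KT κ T))) := by
  set K := KT κ T with hK
  have hKc : IsCompact K := isCompact_KT κ T
  have hKm : MeasurableSet K := hKc.measurableSet
  have hD : AEMeasurable (fun x => ‖r0 x - R0 x‖ₑ) :=
    (hr0.aestronglyMeasurable.sub hR0.aestronglyMeasurable).enorm
  obtain ⟨D, hDm, hDle, hDae⟩ := exists_measurable_ge_ae_eq hD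
  set E := (∫⁻ x in Icc (-κ) κ, ‖r1 x - R1 x‖ₑ) + L * ‖μ - m‖ₑ * volume K with hE
  have hsub := hv.sub hW
  have key := weighted_gronwall hκ hT L hl hlL (fun p => ‖v p - W p‖ₑ)
    (fun p => (D (p.1 + (-1) * p.2) + D (p.1 + 1 * p.2)) + E)
    hsub.aestronglyMeasurable.enorm hsub.hasFiniteIntegral.ne ?_
  · refine key.trans ?_
    gcongr
    have hm1 : Measurable fun p : ℝ × ℝ => D (p.1 + 1 * p.2) := hDm.comp (by fun_prop)
    rw [lintegral_add_right _ measurable_const, lintegral_add_right _ hm1,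
      lintegral_const, Measure.restrict_apply_univ]
    have e : ∫⁻ x in Icc (-κ) κ, ‖r0 x - R0 x‖ₑ = ∫⁻ x in Icc (-κ) κ, D x :=
      lintegral_congr_ae (ae_restrict_of_ae hDae)
    rw [e, two_mul]
    gcongr
    · exact lintegral_shift hT hDm (-1) (by simp)
    · exact lintegral_shift hT hDm 1 (by simp)
  · have hmem : ∀ᵐ p ∂(volume.restrict K), p ∈ K := ae_restrict_mem hKm
    filter_upwards [ae_restrict_of_ae hWeq, hmem] with p hp hpK
    obtain ⟨x, t⟩ := p
    have ht : 0 ≤ t := hpK.1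
    have hxt : |x| ≤ κ - t := hpK.2.2
    rw [abs_le] at hxt
    have hTK : Tri (x, t) ⊆ K := Tri_subset_KT hpK
    have hF1 := (integrableOn_nonlin hL h0 μ hKc hv).mono_set hTK
    have hF2 := (integrableOn_nonlin hL h0 m hKc hW).mono_set hTK
    have e1 := tri_integral ht hF1
    have e2 := tri_integral ht hF2
    have hp' := hp ht
    simp only at hp' e1 e2
    have hv' := hveq x t ht
    rw [e1] at hv'
    rw [e2] at hp'
    have hii : ∀ {r : ℝ → ℝ}, LocallyIntegrable r → IntervalIntegrable r volume (x - t) (x + t) :=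
      fun h => (h.integrableOn_isCompact isCompact_uIcc).intervalIntegrable
    have hdiff : v (x, t) - W (x, t) =
        (1/2) * ((r0 (x - t) - R0 (x - t)) + (r0 (x + t) - R0 (x + t)))
        + (1/2) * (∫ y in (x - t)..(x + t), (r1 y - R1 y))
        + (1/2) * ∫ q in Tri (x, t), (f (μ * indSigma q.1 q.2 + v q)
            - f (m * indSigma q.1 q.2 + W q)) := by
      rw [intervalIntegral.integral_sub (hii hr1) (hii hR1),
        integral_sub hF1 hF2, hv', hp']
      ring
    have b1 : ‖∫ y in (x - t)..(x + t), (r1 y - R1 y)‖ₑ ≤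
        ∫⁻ x in Icc (-κ) κ, ‖r1 x - R1 x‖ₑ := by
      rw [intervalIntegral.integral_of_le (by linarith)]
      refine (enorm_integral_le_lintegral_enorm _).trans (lintegral_mono_set ?_)
      intro y hy
      constructor <;> linarith [hy.1, hy.2]
    have b2 : ‖∫ q in Tri (x, t), (f (μ * indSigma q.1 q.2 + v q)
            - f (m * indSigma q.1 q.2 + W q))‖ₑ ≤
        L * ‖μ - m‖ₑ * volume K + ∫⁻ q in Tri (x, t), L * ‖v q - W q‖ₑ := by
      calc _ ≤ ∫⁻ q in Tri (x, t), ‖f (μ * indSigma q.1 q.2 + v q)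
            - f (m * indSigma q.1 q.2 + W q)‖ₑ := enorm_integral_le_lintegral_enorm _
        _ ≤ ∫⁻ q in Tri (x, t), (L * ‖μ - m‖ₑ + L * ‖v q - W q‖ₑ) := by
            refine lintegral_mono fun q => ?_
            rw [← edist_eq_enorm_sub]
            refine (hL.edist_le_mul _ _).trans ?_
            rw [← mul_add, edist_eq_enorm_sub]
            gcongr
            have : μ * indSigma q.1 q.2 + v q - (m * indSigma q.1 q.2 + W q) =
              (μ - m) * indSigma q.1 q.2 + (v q - W q) := by ring
            rw [this]
            refine (enorm_add_le _ _).trans ?_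
            gcongr
            rw [enorm_mul]
            have h1 : ‖indSigma q.1 q.2‖ₑ ≤ 1 := by
              rw [← ofReal_norm]
              exact ENNReal.ofReal_le_one.2 (abs_indSigma_le _ _)
            calc _ ≤ ‖μ - m‖ₑ * 1 := by gcongr
              _ = _ := mul_one _
        _ = L * ‖μ - m‖ₑ * volume (Tri (x, t)) + ∫⁻ q in Tri (x, t), L * ‖v q - W q‖ₑ := by
            rw [lintegral_add_left measurable_const, lintegral_const,
              Measure.restrict_apply_univ]
        _ ≤ _ := by gcongr
    rw [hdiff]
    refine (enorm_half_sum _ _ _ _).trans ?_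
    have d1 : ‖r0 (x - t) - R0 (x - t)‖ₑ ≤ D (x + (-1) * t) := by
      have : x + (-1) * t = x - t := by ring
      rw [this]; exact hDle _
    have d2 : ‖r0 (x + t) - R0 (x + t)‖ₑ ≤ D (x + 1 * t) := by
      rw [one_mul]; exact hDle _
    calc _ ≤ D (x + (-1) * t) + D (x + 1 * t) + (∫⁻ x in Icc (-κ) κ, ‖r1 x - R1 x‖ₑ) +
          (L * ‖μ - m‖ₑ * volume K + ∫⁻ q in Tri (x, t), L * ‖v q - W q‖ₑ) := by gcongr
      _ = _ := by simp only [hE]; ring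

lemma lintegral_conv {r : ℝ → ℝ → ℝ} {R : ℝ → ℝ} (hr : ∀ ε ∈ Set.Ioc (0:ℝ) 1, LocallyIntegrable (r ε))
    (hR : LocallyIntegrable R) {K : Set ℝ} (hK : IsCompact K)
    (h : Tendsto (fun ε => ∫ x in K, |r ε x - R x|) (𝓝[>] (0:ℝ)) (𝓝 0)) :
    Tendsto (fun ε => ∫⁻ x in K, ‖r ε x - R x‖ₑ) (𝓝[>] (0:ℝ)) (𝓝 0) := by
  have h' := ENNReal.tendsto_ofReal h
  rw [ENNReal.ofReal_zero] at h'
  refine h'.congr' ?_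
  filter_upwards [Ioc_mem_nhdsGT (zero_lt_one (α := ℝ))] with ε hε
  exact ofReal_integral_norm_eq_lintegral_enorm
    (((hr ε hε).integrableOn_isCompact hK).sub (hR.integrableOn_isCompact hK))

/-- Stability of the modified problem: if `M_ε → m` and the regular parts of the
data converge in `L¹_loc`, then the solutions `w_ε` of the integral equation with
forcing `f(M_ε 𝟙_Σ + w_ε)` converge in `L¹(K_T)` to the solution `w` of the
limiting equation. -/
theorem modified_problem_L1_convergence
    (f : ℝ → ℝ) (hf : Admissible f)
    (M : ℝ → ℝ) (m : ℝ) (hM : Tendsto M (𝓝[>] (0:ℝ)) (𝓝 m))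
    (r0 r1 : ℝ → ℝ → ℝ)
    (hr0smooth : ∀ ε ∈ Set.Ioc (0:ℝ) 1, ContDiff ℝ (⊤ : ℕ∞) (r0 ε))
    (hr1smooth : ∀ ε ∈ Set.Ioc (0:ℝ) 1, ContDiff ℝ (⊤ : ℕ∞) (r1 ε))
    (R0 R1 : ℝ → ℝ) (hR0 : LocallyIntegrable R0) (hR1 : LocallyIntegrable R1)
    (hr0conv : ∀ K : Set ℝ, IsCompact K →
      Tendsto (fun ε => ∫ x in K, |r0 ε x - R0 x|) (𝓝[>] (0:ℝ)) (𝓝 0))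
    (hr1conv : ∀ K : Set ℝ, IsCompact K →
      Tendsto (fun ε => ∫ x in K, |r1 ε x - R1 x|) (𝓝[>] (0:ℝ)) (𝓝 0))
    (w : ℝ → ℝ × ℝ → ℝ)
    (hwcont : ∀ ε ∈ Set.Ioc (0:ℝ) 1, ContinuousOn (w ε) {p : ℝ × ℝ | 0 ≤ p.2})
    (hweq : ∀ ε ∈ Set.Ioc (0:ℝ) 1, ∀ x t : ℝ, 0 ≤ t →
      w ε (x, t) = (1/2) * (r0 ε (x - t) + r0 ε (x + t))
        + (1/2) * (∫ y in (x - t)..(x + t), r1 ε y)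
        + (1/2) * ∫ s in (0:ℝ)..t, ∫ y in (x - t + s)..(x + t - s),
            f (M ε * indSigma y s + w ε (y, s)))
    (W : ℝ × ℝ → ℝ) (hWloc : LocallyIntegrableOn W {p : ℝ × ℝ | 0 ≤ p.2})
    (hWeq : ∀ᵐ p : ℝ × ℝ, 0 ≤ p.2 →
      W p = (1/2) * (R0 (p.1 - p.2) + R0 (p.1 + p.2))
        + (1/2) * (∫ y in (p.1 - p.2)..(p.1 + p.2), R1 y)
        + (1/2) * ∫ s in (0:ℝ)..p.2, ∫ y in (p.1 - p.2 + s)..(p.1 + p.2 - s),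
            f (m * indSigma y s + W (y, s))) :
    ∀ κ : ℝ, 0 < κ → ∀ T : ℝ, 0 ≤ T → T ≤ κ →
      Tendsto (fun ε => ∫ p in KT κ T, |w ε p - W p|) (𝓝[>] (0:ℝ)) (𝓝 0) := by
  intro κ hκ T hT0 hT
  obtain ⟨L, hL⟩ := admissible_lipschitz hf
  have hl0 : 0 < 4 * κ * L + 1 := by positivity
  have hKc : IsCompact (KT κ T) := isCompact_KT κ T
  have hKsub : KT κ T ⊆ {p : ℝ × ℝ | 0 ≤ p.2} := fun p hp => hp.1
  have hW : IntegrableOn W (KT κ T) := hWloc.integrableOn_compact_subset hKsub hKc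
  have hvI : ∀ ε ∈ Set.Ioc (0:ℝ) 1, IntegrableOn (w ε) (KT κ T) := fun ε hε =>
    ((hwcont ε hε).mono hKsub).integrableOn_compact hKc
  have hr0 : ∀ ε ∈ Set.Ioc (0:ℝ) 1, LocallyIntegrable (r0 ε) := fun ε hε =>
    (hr0smooth ε hε).continuous.locallyIntegrable
  have hr1 : ∀ ε ∈ Set.Ioc (0:ℝ) 1, LocallyIntegrable (r1 ε) := fun ε hε =>
    (hr1smooth ε hε).continuous.locallyIntegrable
  have c0 := lintegral_conv hr0 hR0 isCompact_Icc (hr0conv (Icc (-κ) κ) isCompact_Icc)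
  have c1 := lintegral_conv hr1 hR1 isCompact_Icc (hr1conv (Icc (-κ) κ) isCompact_Icc)
  have cM : Tendsto (fun ε => ‖M ε - m‖ₑ) (𝓝[>] (0:ℝ)) (𝓝 0) := by
    have := (hM.sub_const m).enorm
    simpa using this
  have hvol : volume (KT κ T) ≠ ∞ := hKc.measure_lt_top.ne
  have hB : Tendsto (fun ε => ENNReal.ofReal (Real.exp ((4 * κ * L + 1) * κ)) * (2 *
      (2 * (ENNReal.ofReal κ * ∫⁻ x in Icc (-κ) κ, ‖r0 ε x - R0 x‖ₑ) +
        ((∫⁻ x in Icc (-κ) κ, ‖r1 ε x - R1 x‖ₑ) + L * ‖M ε - m‖ₑ * volume (KT κ T)) *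
          volume (KT κ T)))) (𝓝[>] (0:ℝ)) (𝓝 0) := by
    have t0 := ENNReal.Tendsto.const_mul (a := 2) (ENNReal.Tendsto.const_mul
      (a := ENNReal.ofReal κ) c0 (Or.inr ENNReal.ofReal_ne_top)) (Or.inr (by simp))
    have t1 := ENNReal.Tendsto.mul_const (b := volume (KT κ T))
      (ENNReal.Tendsto.const_mul (a := (L : ℝ≥0∞)) cM (Or.inr (by simp))) (Or.inr hvol)
    have t2 := ENNReal.Tendsto.mul_const (b := volume (KT κ T)) (c1.add t1) (Or.inr hvol)
    have t3 := ENNReal.Tendsto.const_mul (a := ENNReal.ofReal (Real.exp ((4 * κ * L + 1) * κ)))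
      (ENNReal.Tendsto.const_mul (a := 2) (t0.add t2) (Or.inr (by simp)))
      (Or.inr ENNReal.ofReal_ne_top)
    simpa using t3
  have hU : Tendsto (fun ε => ∫⁻ p in KT κ T, ‖w ε p - W p‖ₑ) (𝓝[>] (0:ℝ)) (𝓝 0) := by
    refine tendsto_of_tendsto_of_tendsto_of_le_of_le' tendsto_const_nhds hB
      (Eventually.of_forall fun _ => zero_le) ?_
    filter_upwards [Ioc_mem_nhdsGT (zero_lt_one (α := ℝ))] with ε hε
    exact stability_estimate hL hf.2.1 hκ hT hl0 (by linarith) (M ε) m (r0 ε) (r1 ε) R0 R1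
      (hr0 ε hε) (hr1 ε hε) hR0 hR1 (w ε) W (hvI ε hε) hW (hweq ε hε) hWeq
  have hfinal := (ENNReal.tendsto_toReal ENNReal.zero_ne_top).comp hU
  rw [ENNReal.toReal_zero] at hfinal
  refine hfinal.congr' ?_
  filter_upwards [Ioc_mem_nhdsGT (zero_lt_one (α := ℝ))] with ε hε
  exact (integral_norm_eq_lintegral_enorm
    ((hvI ε hε).sub hW).aestronglyMeasurable).symm
end
end
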